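/- (Generalized evolution by mean curvature, Euclidean case.) Let N ≥ 1 and θ ≥ 0, and take p = 2, m = 1, a ≡ 1, V ≡ 1 and f(s) = (s²+1)^{−θ} (so 0 ≤ f ≤ 1) in the setting. If 1 < q ≤ 1 + 2/N, then every global nonnegative weak solution of ∂_t u ≥ div( ∇u/(|∇u|²+1)^{θ} ) + u^q on S = ℝ^N × (0,∞) is zero a.e. For θ = 1/2 this is the mean curvature equation for graphs with an additional reaction term. -/

import Mathlib

open MeasureTheory Real Set Metric
open scoped ENNReal RealInnerProductSpace

noncomputable section

/-- Euclidean space `ℝ^N`. -/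
abbrev Euc (N : ℕ) : Type := EuclideanSpace ℝ (Fin N)

/-- The parabolic slab `S = ℝ^N × (0,∞)`. -/
def Sset (N : ℕ) : Set (Euc N × ℝ) := {z : Euc N × ℝ | 0 < z.2}

/-- The weighted measure `μ_a = a(x) dx` on `ℝ^N`. -/
def muA {N : ℕ} (a : Euc N → ℝ) : Measure (Euc N) :=
  (volume : Measure (Euc N)).withDensity (fun x => ENNReal.ofReal (a x))

/-- The measure `dμ_a dt` on `ℝ^N × (0,∞)`. -/
def muS {N : ℕ} (a : Euc N → ℝ) : Measure (Euc N × ℝ) :=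
  (muA a).prod ((volume : Measure ℝ).restrict (Set.Ioi (0 : ℝ)))

/-- The continuous linear functional `(w, τ) ↦ ⟪v, w⟫ + c·τ` on `ℝ^N × ℝ`,
encoding a space-time differential with spatial gradient `v` and time derivative `c`. -/
def pairCLM {N : ℕ} (v : Euc N) (c : ℝ) : (Euc N × ℝ) →L[ℝ] ℝ :=
  ((innerSL ℝ v).comp (ContinuousLinearMap.fst ℝ (Euc N) ℝ)) +
    c • (ContinuousLinearMap.snd ℝ (Euc N) ℝ)

/-- `u` is a global nonnegative weak solution of
`∂ₜ u ≥ (1/a) div(a u^{m-1} |∇u|^{p-2} f(|∇u|) ∇u) + V u^q` on `S = ℝ^N × (0,∞)`,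
where `gu`, `ut` are a.e. representatives of the spatial gradient and the time
derivative of `u`. -/
structure IsWeakSol (N : ℕ) (p m q : ℝ) (V : Euc N × ℝ → ℝ) (f : ℝ → ℝ)
    (a : Euc N → ℝ) (u : Euc N × ℝ → ℝ) (gu : Euc N × ℝ → Euc N)
    (ut : Euc N × ℝ → ℝ) : Prop where
  nonneg : ∀ z ∈ Sset N, 0 ≤ u z
  locLip : LocallyLipschitzOn (Sset N) u
  deriv_ae : ∀ᵐ z ∂ ((volume : Measure (Euc N × ℝ)).restrict (Sset N)),
      DifferentiableAt ℝ u z → HasFDerivAt u (pairCLM (gu z) (ut z)) z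
  int_uqV : LocallyIntegrableOn (fun z => u z ^ q * V z) (Sset N) (muS a)
  int_upm : LocallyIntegrableOn (fun z => u z ^ (p + m - 1)) (Sset N) (muS a)
  int_gu : LocallyIntegrableOn (fun z => ‖gu z‖ ^ p * u z ^ (m - 1)) (Sset N) (muS a)
  int_ut : LocallyIntegrableOn (fun z => u z * ut z) (Sset N) (muS a)
  weak_ineq : ∀ (ψ : Euc N × ℝ → ℝ) (gψ : Euc N × ℝ → Euc N) (tψ : Euc N × ℝ → ℝ),
      (∀ z, 0 ≤ ψ z) → LocallyLipschitz ψ → HasCompactSupport ψ →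
      tsupport ψ ⊆ Sset N →
      (∀ᵐ z ∂ (volume : Measure (Euc N × ℝ)),
        DifferentiableAt ℝ ψ z → HasFDerivAt ψ (pairCLM (gψ z) (tψ z)) z) →
      ∫ z, ψ z * u z ^ q * V z ∂ muS a ≤
        (∫ z, ⟪gψ z, gu z⟫ * u z ^ (m - 1) * ‖gu z‖ ^ (p - 2) * f ‖gu z‖ ∂ muS a)
          - ∫ z, tψ z * u z ∂ muS a

/-- The region `E_R = {(x,t) ∈ S : |x|^θ2 + t^θ1 ≤ R^θ2}`. -/
def ESet (N : ℕ) (θ1 θ2 R : ℝ) : Set (Euc N × ℝ) :=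
  {z ∈ Sset N | ‖z.1‖ ^ θ2 + z.2 ^ θ1 ≤ R ^ θ2}

/-- The time cutoff `χ_β`. -/
def chi (β t : ℝ) : ℝ := min 1 (max 0 (t / β - 1))

section Auxiliary

open Filter Topology

lemma LocallyLipschitz.exists_lipschitzWith_of_hasCompactSupport {E : Type*}
    [NormedAddCommGroup E] [ProperSpace E] {F : E → ℝ}
    (hF : LocallyLipschitz F) (hc : HasCompactSupport F) : ∃ C, LipschitzWith C F := by
  obtain ⟨r, hr⟩ := (isCompact_iff_isClosed_bounded.1 hc).2.subset_closedBall (0 : E)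
  obtain ⟨C, hC⟩ := (hF.locallyLipschitzOn (s := closedBall (0 : E) (r + 1))
    ).exists_lipschitzOnWith_of_compact (isCompact_closedBall _ _)
  obtain ⟨M, hM⟩ := hc.exists_bound_of_continuous hF.continuous
  have hM0 : 0 ≤ M := (norm_nonneg _).trans (hM 0)
  have key : ∀ x y, dist (F x) (F y) ≤ ((C : ℝ) + M) * dist x y := by
    have far : ∀ x y, x ∈ closedBall (0 : E) r → y ∉ closedBall (0 : E) (r + 1) →
        dist (F x) (F y) ≤ ((C : ℝ) + M) * dist x y := by
      intro x y hx hy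
      have hFy : F y = 0 := image_eq_zero_of_notMem_tsupport
        fun h => hy (closedBall_subset_closedBall (by linarith) (hr h))
      have hd : 1 ≤ dist x y := by
        simp only [mem_closedBall, not_le] at hx hy
        have := dist_triangle y x 0
        rw [dist_comm y x] at this
        linarith
      rw [hFy, dist_zero_right]
      have hCn : (0 : ℝ) ≤ C := C.2
      nlinarith [hM x]
    intro x y
    have hCn : (0 : ℝ) ≤ C := C.2
    by_cases hx : x ∈ closedBall (0 : E) (r + 1) <;> by_cases hy : y ∈ closedBall (0 : E) (r + 1)
    · exact (hC.dist_le_mul x hx y hy).trans (by gcongr; linarith)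
    · by_cases hx' : x ∈ closedBall (0 : E) r
      · exact far x y hx' hy
      · have h1 : F x = 0 := image_eq_zero_of_notMem_tsupport fun h => hx' (hr h)
        have h2 : F y = 0 := image_eq_zero_of_notMem_tsupport
          fun h => hy (closedBall_subset_closedBall (by linarith) (hr h))
        rw [h1, h2, dist_self]; positivity
    · by_cases hy' : y ∈ closedBall (0 : E) r
      · rw [dist_comm, dist_comm x]; exact far y x hy' hx
      · have h1 : F y = 0 := image_eq_zero_of_notMem_tsupport fun h => hy' (hr h)
        have h2 : F x = 0 := image_eq_zero_of_notMem_tsupport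
          fun h => hx (closedBall_subset_closedBall (by linarith) (hr h))
        rw [h1, h2, dist_self]; positivity
    · have h1 : F x = 0 := image_eq_zero_of_notMem_tsupport
          fun h => hx (closedBall_subset_closedBall (by linarith) (hr h))
      have h2 : F y = 0 := image_eq_zero_of_notMem_tsupport
          fun h => hy (closedBall_subset_closedBall (by linarith) (hr h))
      rw [h1, h2, dist_self]; positivity
  refine ⟨(C : NNReal) + ⟨M, hM0⟩, LipschitzWith.of_dist_le_mul fun x y => ?_⟩
  exact key x y

lemma locallyLipschitz_mul_comp {E : Type*} [NormedAddCommGroup E] [NormedSpace ℝ E] {S : Set E}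
    (hS : IsOpen S) {φ u : E → ℝ} {G : ℝ → ℝ} (hφ : ContDiff ℝ 1 φ) (hφS : tsupport φ ⊆ S)
    (hu : LocallyLipschitzOn S u) (hG : ∀ z ∈ S, ContDiffAt ℝ 1 G (u z)) :
    LocallyLipschitz (fun z => φ z * G (u z)) := by
  intro z
  by_cases hz : z ∈ S
  · have hm : ContDiffAt ℝ 1 (fun p : ℝ × ℝ => p.1 * G p.2) (φ z, u z) :=
      contDiffAt_fst.mul ((hG z hz).comp (φ z, u z) contDiffAt_snd)
    obtain ⟨K, t, ht, hK⟩ := hm.exists_lipschitzOnWith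
    obtain ⟨K₁, t₁, ht₁, hK₁⟩ := hu hz
    rw [hS.nhdsWithin_eq hz] at ht₁
    obtain ⟨K₂, t₂, ht₂, hK₂⟩ := hφ.locallyLipschitz z
    have hcu : ContinuousAt u z := (hu.continuousOn.continuousAt (hS.mem_nhds hz))
    have hpair : ContinuousAt (fun w => (φ w, u w)) z := hφ.continuous.continuousAt.prodMk hcu
    refine ⟨K * max K₂ K₁, t₁ ∩ t₂ ∩ (fun w => (φ w, u w)) ⁻¹' t,
      inter_mem (inter_mem ht₁ ht₂) (hpair ht), ?_⟩
    exact hK.comp (((hK₂.mono fun x hx => hx.1.2).prodMk (hK₁.mono fun x hx => hx.1.1)))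
      (fun x hx => hx.2)
  · have h0 : φ =ᶠ[𝓝 z] 0 := notMem_tsupport_iff_eventuallyEq.1 fun h => hz (hφS h)
    refine ⟨0, _, h0, LipschitzOnWith.of_dist_le_mul fun x hx y hy => ?_⟩
    have h1 : φ x = 0 := hx
    have h2 : φ y = 0 := hy
    simp [h1, h2]

lemma LocallyLipschitzOn.ae_differentiableAt {E : Type*} [NormedAddCommGroup E] [NormedSpace ℝ E]
    [FiniteDimensional ℝ E] [MeasurableSpace E] [BorelSpace E] {μ : Measure E}
    [μ.IsAddHaarMeasure] {S : Set E} (hS : IsOpen S) {u : E → ℝ} (hu : LocallyLipschitzOn S u) :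
    ∀ᵐ z ∂μ.restrict S, DifferentiableAt ℝ u z := by
  rw [ae_restrict_iff' hS.measurableSet]
  have := FiniteDimensional.proper_real E
  have : μ {z | z ∈ S ∧ ¬ DifferentiableAt ℝ u z} = 0 := by
    refine measure_null_of_locally_null _ fun z hz => ?_
    obtain ⟨K, t, ht, hK⟩ := hu hz.1
    rw [hS.nhdsWithin_eq hz.1] at ht
    obtain ⟨t', hsub, hopen, hzt'⟩ := _root_.mem_nhds_iff.1 ht
    refine ⟨t' ∩ {z | z ∈ S ∧ ¬ DifferentiableAt ℝ u z}, inter_mem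
      (mem_nhdsWithin_of_mem_nhds (hopen.mem_nhds hzt')) self_mem_nhdsWithin, ?_⟩
    have h := (hK.mono hsub).ae_differentiableWithinAt_of_mem (μ := μ)
    refine measure_mono_null (fun x hx => ?_) h
    intro hh
    exact hx.2.2 ((hh hx.1).differentiableAt (hopen.mem_nhds hx.1))
  filter_upwards [measure_eq_zero_iff_ae_notMem.1 this] with z hz hzS
  by_contra h
  exact hz ⟨hzS, h⟩

lemma LocallyLipschitz.integral_lineDeriv_eq_zero {E : Type*} [NormedAddCommGroup E]
    [NormedSpace ℝ E] [FiniteDimensional ℝ E] [MeasurableSpace E] [BorelSpace E] {μ : Measure E}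
    [μ.IsAddHaarMeasure] {F : E → ℝ} (hF : LocallyLipschitz F) (hc : HasCompactSupport F) (v : E) :
    ∫ z, lineDeriv ℝ F z v ∂μ = 0 := by
  have := FiniteDimensional.proper_real E
  obtain ⟨C, hC⟩ := hF.exists_lipschitzWith_of_hasCompactSupport hc
  have h := LipschitzWith.integral_lineDeriv_mul_eq (μ := μ)
    (LipschitzWith.const (α := E) (1 : ℝ)) hC hc (-v)
  simpa [lineDeriv] using h.symm

/-- The bounded decreasing profile `y ↦ 1 + (1 + y/σ)^{-d}`. -/
def profile (σ d y : ℝ) : ℝ := 1 + (1 + y / σ) ^ (-d)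

/-- The derivative of `profile`. -/
def profileDeriv (σ d y : ℝ) : ℝ := -(d / σ) * (1 + y / σ) ^ (-d - 1)

/-- A nonnegative primitive of `profile`. -/
def profilePrim (σ d y : ℝ) : ℝ := y + σ / (1 - d) * (1 + y / σ) ^ (1 - d)

section Profile

variable {σ d y : ℝ}

lemma one_le_one_add_div (hσ : 0 < σ) (hy : 0 ≤ y) : 1 ≤ 1 + y / σ := by
  have : 0 ≤ y / σ := by positivity
  linarith

lemma hasDerivAt_profile (hσ : 0 < σ) (hy : 0 ≤ y) :
    HasDerivAt (profile σ d) (profileDeriv σ d y) y := by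
  have h1 := one_le_one_add_div hσ hy
  have h := (((hasDerivAt_id y).div_const σ).const_add 1).rpow_const (p := -d)
    (Or.inl (by simp only [id]; linarith))
  refine (show HasDerivAt (profile σ d) _ y from h.const_add 1).congr_deriv ?_
  simp only [profileDeriv, id]
  ring

lemma hasDerivAt_profilePrim (hσ : 0 < σ) (hd : d < 1) (hy : 0 ≤ y) :
    HasDerivAt (profilePrim σ d) (profile σ d y) y := by
  have h1 := one_le_one_add_div hσ hy
  have h := (((hasDerivAt_id y).div_const σ).const_add 1).rpow_const (p := 1 - d)
    (Or.inl (by simp only [id]; linarith))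
  refine (show HasDerivAt (profilePrim σ d) _ y from
    (hasDerivAt_id y).add (h.const_mul (σ / (1 - d)))).congr_deriv ?_
  have : 1 - d ≠ 0 := by linarith
  have e : (1 : ℝ) - d - 1 = -d := by ring
  simp only [profile, id, e]
  field_simp

lemma contDiffAt_one_add_div_rpow (hσ : 0 < σ) (hy : 0 ≤ y) (p : ℝ) :
    ContDiffAt ℝ 1 (fun y => (1 + y / σ) ^ p) y := by
  have h1 := one_le_one_add_div hσ hy
  exact ((contDiffAt_const.add (contDiffAt_id.div_const σ))).rpow_const_of_ne
    (by simp only [id]; linarith)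

lemma contDiffAt_profile (hσ : 0 < σ) (hy : 0 ≤ y) : ContDiffAt ℝ 1 (profile σ d) y :=
  contDiffAt_const.add (contDiffAt_one_add_div_rpow hσ hy _)

lemma contDiffAt_profileDeriv (hσ : 0 < σ) (hy : 0 ≤ y) :
    ContDiffAt ℝ 1 (profileDeriv σ d) y :=
  contDiffAt_const.mul (contDiffAt_one_add_div_rpow hσ hy _)

lemma contDiffAt_profilePrim (hσ : 0 < σ) (hy : 0 ≤ y) :
    ContDiffAt ℝ 1 (profilePrim σ d) y :=
  contDiffAt_id.add (contDiffAt_const.mul (contDiffAt_one_add_div_rpow hσ hy _))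

lemma one_le_profile (hσ : 0 < σ) (hy : 0 ≤ y) : 1 ≤ profile σ d y := by
  have h1 := one_le_one_add_div hσ hy
  have : 0 ≤ (1 + y / σ) ^ (-d) := by positivity
  simp only [profile]; linarith

lemma profile_le_two (hσ : 0 < σ) (hd : 0 < d) (hy : 0 ≤ y) : profile σ d y ≤ 2 := by
  have h1 := one_le_one_add_div hσ hy
  have := rpow_le_one_of_one_le_of_nonpos h1 (by linarith : -d ≤ 0)
  simp only [profile]; linarith

lemma profilePrim_nonneg (hσ : 0 < σ) (hd : d < 1) (hy : 0 ≤ y) : 0 ≤ profilePrim σ d y := by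
  have h1 := one_le_one_add_div hσ hy
  have : 0 < 1 - d := by linarith
  simp only [profilePrim]; positivity

lemma profilePrim_le (hσ : 0 < σ) (hd0 : 0 < d) (hd : d ≤ 1 / 2) (hy : 0 ≤ y) :
    profilePrim σ d y ≤ 3 * σ * (1 + y / σ) ^ (1 + d) := by
  have h1 := one_le_one_add_div hσ hy
  have h2 : (1 + y / σ) ^ (1 - d) ≤ (1 + y / σ) ^ (1 + d) :=
    rpow_le_rpow_of_exponent_le h1 (by linarith)
  have h3 : 1 + y / σ ≤ (1 + y / σ) ^ (1 + d) := by
    nth_rewrite 1 [← rpow_one (1 + y / σ)]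
    exact rpow_le_rpow_of_exponent_le h1 (by linarith)
  have h4 : y ≤ σ * (1 + y / σ) := by
    field_simp; linarith
  have h5 : σ / (1 - d) ≤ 2 * σ := by
    rw [div_le_iff₀ (by linarith)]; nlinarith
  have h6 : 0 ≤ (1 + y / σ) ^ (1 - d) := by positivity
  simp only [profilePrim]
  nlinarith [mul_le_mul h5 h2 h6 (by positivity)]

end Profile

/-- Interpolation of a low power of `v` by a cut off high power. -/
lemma pow_mul_one_add_rpow_le {q d ξ v : ℝ} {n : ℕ} (hd0 : 0 < d) (hd : d ≤ 1 / 2)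
    (hdq : 1 + d < q) (hn : (1 + d) / (q - 1 - d) ≤ n) (hξ0 : 0 ≤ ξ) (hξ1 : ξ ≤ 1)
    (hv : 0 ≤ v) :
    ξ ^ (2 * n) * (1 + v) ^ (1 + d) ≤ 4 * (1 + ξ ^ (2 * n + 2) * v ^ q) := by
  have he : 0 < q - 1 - d := by linarith
  have hP0 : 0 ≤ ξ ^ (2 * n) := by positivity
  have hP1 : ξ ^ (2 * n) ≤ 1 := pow_le_one₀ hξ0 hξ1
  have hQ0 : 0 ≤ ξ ^ (2 * n + 2) * v ^ q := by positivity
  have h2 : (2 : ℝ) ^ (1 + d) ≤ 4 := by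
    calc (2 : ℝ) ^ (1 + d) ≤ 2 ^ (2 : ℝ) :=
          rpow_le_rpow_of_exponent_le (by norm_num) (by linarith)
      _ = 4 := by norm_num
  rcases le_total v 1 with h | h
  · have h3 : (1 + v) ^ (1 + d) ≤ 4 :=
      (rpow_le_rpow (by linarith) (by linarith) (by linarith)).trans h2
    have h4 : 0 ≤ (1 + v) ^ (1 + d) := by positivity
    nlinarith [mul_le_mul hP1 h3 h4 zero_le_one]
  · have h3 : (1 + v) ^ (1 + d) ≤ 4 * v ^ (1 + d) := by
      calc (1 + v) ^ (1 + d) ≤ (2 * v) ^ (1 + d) :=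
            rpow_le_rpow (by linarith) (by linarith) (by linarith)
        _ = 2 ^ (1 + d) * v ^ (1 + d) := mul_rpow (by norm_num) hv
        _ ≤ 4 * v ^ (1 + d) := by gcongr
    have hvq : v ^ q = v ^ (q - 1 - d) * v ^ (1 + d) := by
      rw [← rpow_add (by linarith)]; congr 1; ring
    have hmain : ξ ^ (2 * n) * v ^ (1 + d) ≤ 1 + ξ ^ (2 * n + 2) * v ^ q := by
      have hv1 : 0 ≤ v ^ (1 + d) := by positivity
      rcases le_total 1 (ξ ^ 2 * v ^ (q - 1 - d)) with hc | hc
      · have : ξ ^ (2 * n + 2) * v ^ q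
            = (ξ ^ 2 * v ^ (q - 1 - d)) * (ξ ^ (2 * n) * v ^ (1 + d)) := by
          rw [hvq, pow_add]; ring
        rw [this]
        nlinarith [mul_nonneg hP0 hv1]
      · have h5 : v ^ (1 + d) ≤ (v ^ (q - 1 - d)) ^ n := by
          rw [← rpow_mul_natCast hv]
          refine rpow_le_rpow_of_exponent_le h ?_
          rw [div_le_iff₀ he] at hn; linarith
        have h6 : ξ ^ (2 * n) * (v ^ (q - 1 - d)) ^ n ≤ 1 := by
          rw [pow_mul, ← mul_pow]; exact pow_le_one₀ (by positivity) hc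
        nlinarith [mul_le_mul_of_nonneg_left h5 hP0]
    nlinarith [mul_le_mul_of_nonneg_left h3 hP0]

/-- Completing the square in the gradient term. -/
lemma two_mul_sub_mul_sq_le {A B y : ℝ} (hB : 0 < B) : 2 * A * y - B * y ^ 2 ≤ A ^ 2 / B := by
  rw [le_div_iff₀ hB]; nlinarith [sq_nonneg (A - B * y)]

/-- The derivative of `Real.smoothTransition`. -/
def stepDeriv (x : ℝ) : ℝ := deriv smoothTransition x

lemma hasDerivAt_smoothTransition (x : ℝ) :
    HasDerivAt smoothTransition (stepDeriv x) x :=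
  ((smoothTransition.contDiff (n := 1)).differentiable one_ne_zero x).hasDerivAt

lemma continuous_stepDeriv : Continuous stepDeriv :=
  (smoothTransition.contDiff (n := 1)).continuous_deriv_one

lemma stepDeriv_nonneg (x : ℝ) : 0 ≤ stepDeriv x := smoothTransition.monotone.deriv_nonneg

lemma stepDeriv_of_nonpos {x : ℝ} (hx : x ≤ 0) : stepDeriv x = 0 :=
  IsLocalMin.deriv_eq_zero (Eventually.of_forall fun y => by
    rw [smoothTransition.zero_of_nonpos hx]; exact smoothTransition.nonneg y)

lemma stepDeriv_of_one_le {x : ℝ} (hx : 1 ≤ x) : stepDeriv x = 0 :=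
  IsLocalMax.deriv_eq_zero (Eventually.of_forall fun y => by
    rw [smoothTransition.one_of_one_le hx]; exact smoothTransition.le_one y)

lemma exists_stepDeriv_le : ∃ M, 0 ≤ M ∧ ∀ x, stepDeriv x ≤ M := by
  obtain ⟨M, hM⟩ := (isCompact_Icc (a := (0 : ℝ)) (b := 1)).exists_bound_of_continuousOn
    continuous_stepDeriv.continuousOn
  have hM0 : 0 ≤ M := (norm_nonneg _).trans (hM 0 (by simp))
  refine ⟨M, hM0, fun x => ?_⟩
  rcases le_total x 0 with h | h
  · rwa [stepDeriv_of_nonpos h]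
  rcases le_total 1 x with h' | h'
  · rwa [stepDeriv_of_one_le h']
  exact (le_abs_self _).trans (hM x ⟨h, h'⟩)

section Cutoff

variable {N : ℕ}

/-- The cutoff in time near `t = 0`. -/
def timeCut (β : ℝ) (z : Euc N × ℝ) : ℝ := smoothTransition (z.2 / β - 1)

/-- The argument of the parabolic cutoff. -/
def parabArg (R : ℝ) (z : Euc N × ℝ) : ℝ := 2 - (‖z.1‖ ^ 2 + z.2) / R ^ 2

/-- The parabolic cutoff at scale `R`. -/
def parabCut (R : ℝ) (z : Euc N × ℝ) : ℝ := smoothTransition (parabArg R z)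

/-- The space-time cutoff. -/
def cutoff (β R : ℝ) (m : ℕ) (z : Euc N × ℝ) : ℝ := timeCut β z * parabCut R z ^ (m + 2)

/-- The common factor of the derivatives of `cutoff` coming from the parabolic cutoff. -/
def cutoffCoef (β R : ℝ) (m : ℕ) (z : Euc N × ℝ) : ℝ :=
  timeCut β z * ((m + 2) * parabCut R z ^ (m + 1) * stepDeriv (parabArg R z)) / R ^ 2

/-- The spatial gradient of `cutoff`. -/
def cutoffGrad (β R : ℝ) (m : ℕ) (z : Euc N × ℝ) : Euc N := (-2 * cutoffCoef β R m z) • z.1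

/-- The time derivative of `cutoff`. -/
def cutoffTime (β R : ℝ) (m : ℕ) (z : Euc N × ℝ) : ℝ :=
  stepDeriv (z.2 / β - 1) / β * parabCut R z ^ (m + 2) - cutoffCoef β R m z

variable {β R : ℝ} {m : ℕ}

lemma contDiff_parabArg : ContDiff ℝ 1 (parabArg (N := N) R) := by
  unfold parabArg
  exact contDiff_const.sub (((contDiff_fst.norm_sq ℝ).add contDiff_snd).div_const _)

lemma contDiff_timeCut : ContDiff ℝ 1 (timeCut (N := N) β) :=
  smoothTransition.contDiff.comp ((contDiff_snd.div_const _).sub contDiff_const)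

lemma contDiff_parabCut : ContDiff ℝ 1 (parabCut (N := N) R) :=
  smoothTransition.contDiff.comp contDiff_parabArg

lemma contDiff_cutoff : ContDiff ℝ 1 (cutoff (N := N) β R m) :=
  contDiff_timeCut.mul (contDiff_parabCut.pow _)

lemma continuous_cutoffCoef : Continuous (cutoffCoef (N := N) β R m) := by
  have h1 : Continuous (timeCut (N := N) β) := contDiff_timeCut.continuous
  have h2 : Continuous (parabCut (N := N) R) := contDiff_parabCut.continuous
  have h3 : Continuous (fun z : Euc N × ℝ => stepDeriv (parabArg R z)) :=
    continuous_stepDeriv.comp contDiff_parabArg.continuous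
  unfold cutoffCoef
  fun_prop

lemma continuous_cutoffGrad : Continuous (cutoffGrad (N := N) β R m) := by
  have := continuous_cutoffCoef (N := N) (β := β) (R := R) (m := m)
  unfold cutoffGrad
  fun_prop

lemma continuous_cutoffTime : Continuous (cutoffTime (N := N) β R m) := by
  have h1 := continuous_cutoffCoef (N := N) (β := β) (R := R) (m := m)
  have h2 : Continuous (parabCut (N := N) R) := contDiff_parabCut.continuous
  have h3 : Continuous (fun z : Euc N × ℝ => stepDeriv (z.2 / β - 1)) :=
    continuous_stepDeriv.comp (by fun_prop)
  unfold cutoffTime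
  fun_prop

lemma timeCut_nonneg (z : Euc N × ℝ) : 0 ≤ timeCut β z := smoothTransition.nonneg _

lemma timeCut_le_one (z : Euc N × ℝ) : timeCut β z ≤ 1 := smoothTransition.le_one _

lemma parabCut_nonneg (z : Euc N × ℝ) : 0 ≤ parabCut R z := smoothTransition.nonneg _

lemma parabCut_le_one (z : Euc N × ℝ) : parabCut R z ≤ 1 := smoothTransition.le_one _

lemma cutoff_nonneg (z : Euc N × ℝ) : 0 ≤ cutoff β R m z :=
  mul_nonneg (timeCut_nonneg z) (pow_nonneg (parabCut_nonneg z) _)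

lemma cutoff_le_one (z : Euc N × ℝ) : cutoff β R m z ≤ 1 :=
  mul_le_one₀ (timeCut_le_one z) (pow_nonneg (parabCut_nonneg z) _)
    (pow_le_one₀ (parabCut_nonneg z) (parabCut_le_one z))

lemma cutoffCoef_nonneg (z : Euc N × ℝ) : 0 ≤ cutoffCoef β R m z := by
  have h1 := timeCut_nonneg (β := β) z
  have h2 := parabCut_nonneg (R := R) z
  have h3 := stepDeriv_nonneg (parabArg R z)
  unfold cutoffCoef
  positivity

lemma hasFDerivAt_cutoff (z : Euc N × ℝ) :
    HasFDerivAt (cutoff β R m) (pairCLM (cutoffGrad β R m z) (cutoffTime β R m z)) z := by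
  have hs : HasFDerivAt (fun w : Euc N × ℝ => w.2) (ContinuousLinearMap.snd ℝ (Euc N) ℝ) z :=
    hasFDerivAt_snd
  have hf : HasFDerivAt (fun w : Euc N × ℝ => w.1) (ContinuousLinearMap.fst ℝ (Euc N) ℝ) z :=
    hasFDerivAt_fst
  have h1 : HasFDerivAt (timeCut β) _ z :=
    (hasDerivAt_smoothTransition _).comp_hasFDerivAt z ((hs.mul_const β⁻¹).sub_const 1)
  have h2 : HasFDerivAt (parabCut R) _ z :=
    (hasDerivAt_smoothTransition _).comp_hasFDerivAt z
      (((hf.norm_sq.add hs).mul_const (R ^ 2)⁻¹).const_sub 2)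
  have h3 := h1.mul (h2.pow (m + 2))
  refine (show HasFDerivAt (cutoff β R m) _ z from h3).congr_fderiv ?_
  ext w
  · simp [pairCLM, cutoffGrad, cutoffTime, cutoffCoef, parabArg]
    ring
  · simp [pairCLM, cutoffGrad, cutoffTime, cutoffCoef, parabArg]
    ring

/-- The compact set carrying the cutoff. -/
def cutoffSet (N : ℕ) (β R : ℝ) : Set (Euc N × ℝ) :=
  {z | β ≤ z.2 ∧ ‖z.1‖ ^ 2 + z.2 ≤ 2 * R ^ 2}

lemma isClosed_cutoffSet : IsClosed (cutoffSet N β R) :=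
  (isClosed_le continuous_const continuous_snd).inter
    (isClosed_le (f := fun z : Euc N × ℝ => ‖z.1‖ ^ 2 + z.2) (by fun_prop) continuous_const)

lemma isCompact_cutoffSet (hβ : 0 < β) (hR : 0 < R) : IsCompact (cutoffSet N β R) := by
  refine ((isCompact_closedBall (0 : Euc N) (2 * R)).prod
    (isCompact_Icc (a := β) (b := 2 * R ^ 2))).of_isClosed_subset isClosed_cutoffSet ?_
  rintro z ⟨h1, h2⟩
  refine ⟨?_, h1, by nlinarith [sq_nonneg ‖z.1‖]⟩
  rw [mem_closedBall_zero_iff]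
  exact abs_le_of_sq_le_sq' (by nlinarith) (by linarith) |>.2

lemma cutoffSet_subset (hβ : 0 < β) : cutoffSet N β R ⊆ Sset N := fun _ hz => hβ.trans_le hz.1

lemma notMem_cutoffSet (hβ : 0 < β) (hR : 0 < R) {z : Euc N × ℝ} (hz : z ∉ cutoffSet N β R) :
    z.2 / β - 1 ≤ 0 ∨ parabArg R z ≤ 0 := by
  by_contra! h
  refine hz ⟨?_, ?_⟩
  · have := h.1
    rw [sub_pos, one_lt_div hβ] at this
    exact this.le
  · have := h.2
    rw [parabArg, sub_pos, div_lt_iff₀ (by positivity)] at this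
    exact this.le

lemma cutoff_eq_zero (hβ : 0 < β) (hR : 0 < R) {z : Euc N × ℝ} (hz : z ∉ cutoffSet N β R) :
    cutoff β R m z = 0 := by
  rcases notMem_cutoffSet hβ hR hz with h | h
  · simp [cutoff, timeCut, smoothTransition.zero_of_nonpos h]
  · simp [cutoff, parabCut, smoothTransition.zero_of_nonpos h]

lemma cutoffCoef_eq_zero (hβ : 0 < β) (hR : 0 < R) {z : Euc N × ℝ}
    (hz : z ∉ cutoffSet N β R) : cutoffCoef β R m z = 0 := by
  rcases notMem_cutoffSet hβ hR hz with h | h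
  · simp [cutoffCoef, timeCut, smoothTransition.zero_of_nonpos h]
  · simp [cutoffCoef, parabCut, smoothTransition.zero_of_nonpos h]

lemma cutoffGrad_eq_zero (hβ : 0 < β) (hR : 0 < R) {z : Euc N × ℝ}
    (hz : z ∉ cutoffSet N β R) : cutoffGrad β R m z = 0 := by
  simp [cutoffGrad, cutoffCoef_eq_zero hβ hR hz]

lemma cutoffTime_eq_zero (hβ : 0 < β) (hR : 0 < R) {z : Euc N × ℝ}
    (hz : z ∉ cutoffSet N β R) : cutoffTime β R m z = 0 := by
  rw [cutoffTime, cutoffCoef_eq_zero hβ hR hz]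
  rcases notMem_cutoffSet hβ hR hz with h | h
  · simp [stepDeriv_of_nonpos h]
  · simp [parabCut, smoothTransition.zero_of_nonpos h]

lemma tsupport_cutoff_subset (hβ : 0 < β) (hR : 0 < R) :
    tsupport (cutoff (N := N) β R m) ⊆ cutoffSet N β R :=
  closure_minimal (fun _ hz => by_contra fun h => hz (cutoff_eq_zero hβ hR h)) isClosed_cutoffSet

/-- The shell where the parabolic cutoff varies. -/
def shell (N : ℕ) (R : ℝ) : Set (Euc N × ℝ) :=
  {z | 0 < z.2 ∧ R ^ 2 ≤ ‖z.1‖ ^ 2 + z.2 ∧ ‖z.1‖ ^ 2 + z.2 ≤ 2 * R ^ 2}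

lemma measurableSet_shell : MeasurableSet (shell N R) := by
  have h : Measurable fun z : Euc N × ℝ => ‖z.1‖ ^ 2 + z.2 := by fun_prop
  exact (measurableSet_lt measurable_const measurable_snd).inter
    ((measurableSet_le measurable_const h).inter (measurableSet_le h measurable_const))

lemma cutoffCoef_eq_zero_of_notMem_shell (hR : 0 < R) {z : Euc N × ℝ} (hz : 0 < z.2)
    (hs : z ∉ shell N R) : cutoffCoef β R m z = 0 := by
  have : stepDeriv (parabArg R z) = 0 := by
    by_contra h
    have h0 : 0 < parabArg R z := not_le.1 fun h' => h (stepDeriv_of_nonpos h')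
    have h1 : parabArg R z < 1 := not_le.1 fun h' => h (stepDeriv_of_one_le h')
    have hR2 : 0 < R ^ 2 := by positivity
    rw [parabArg] at h0 h1
    have h0' := (div_lt_iff₀ hR2).1 (sub_pos.1 h0)
    have h1' : 1 < (‖z.1‖ ^ 2 + z.2) / R ^ 2 := by linarith
    rw [one_lt_div hR2] at h1'
    exact hs ⟨hz, h1'.le, h0'.le⟩
  simp [cutoffCoef, this]

lemma cutoffCoef_le {M : ℝ} (hM : ∀ x, stepDeriv x ≤ M) (z : Euc N × ℝ) :
    cutoffCoef β R m z ≤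
      (timeCut β z * parabCut R z ^ m) * parabCut R z * ((m + 2) * M / R ^ 2) := by
  have h1 := timeCut_nonneg (β := β) z
  have h2 := parabCut_nonneg (R := R) z
  calc cutoffCoef β R m z
      = (timeCut β z * parabCut R z ^ m) * parabCut R z *
          ((m + 2) * stepDeriv (parabArg R z) / R ^ 2) := by
        rw [cutoffCoef, pow_succ]; ring
    _ ≤ _ := by gcongr; exact hM _

end Cutoff

/-- The constant of the a priori estimate. -/
def estConst (d M : ℝ) (m : ℕ) : ℝ := 4 * (16 * ((m + 2) * M) ^ 2 / d + 3 * ((m + 2) * M))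

lemma estConst_nonneg {d M : ℝ} {m : ℕ} (hd : 0 < d) (hM : 0 ≤ M) : 0 ≤ estConst d M m := by
  unfold estConst; positivity

set_option maxHeartbeats 800000 in
/-- The pointwise inequality obtained by absorbing the gradient term. -/
lemma pointwise_estimate {N : ℕ} {σ d q β R M y c : ℝ} {n : ℕ} (hσ : 0 < σ) (hd0 : 0 < d)
    (hd : d ≤ 1 / 2) (hdq : 1 + d < q) (hn : (1 + d) / (q - 1 - d) ≤ n) (hβ : 0 < β) (hR : 0 < R)
    (hM0 : 0 ≤ M) (hM : ∀ x, stepDeriv x ≤ M) (hy : 0 ≤ y) (hc0 : 0 ≤ c) (hc1 : c ≤ 1)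
    {z : Euc N × ℝ} (hz : 0 < z.2) (g : Euc N) :
    ⟪profile σ d y • cutoffGrad β R (2 * n) z
        + (cutoff β R (2 * n) z * profileDeriv σ d y) • g, g⟫ * c
      - cutoffTime β R (2 * n) z * profilePrim σ d y
    ≤ (shell N R).indicator
      (fun z => estConst d M (2 * n) * (σ / R ^ 2) *
        (1 + cutoff β R (2 * n) z * (y / σ) ^ q)) z := by
  have hχ0 := timeCut_nonneg (β := β) z
  have hχ1 := timeCut_le_one (β := β) z
  have hξ0 := parabCut_nonneg (R := R) z
  have hξ1 := parabCut_le_one (R := R) z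
  have hφ0 := cutoff_nonneg (β := β) (R := R) (m := 2 * n) z
  have hκ0 := cutoffCoef_nonneg (β := β) (R := R) (m := 2 * n) z
  have hκ := cutoffCoef_le (β := β) (R := R) (m := 2 * n) hM z
  have hw1 := one_le_one_add_div hσ hy
  have hh1 := one_le_profile (d := d) hσ hy
  have hh2 := profile_le_two hσ hd0 hy
  have hH0 := profilePrim_nonneg hσ (by linarith : d < 1) hy
  have hH := profilePrim_le hσ hd0 hd hy
  have hB : 0 < d / σ * (1 + y / σ) ^ (-d - 1) := by positivity
  have hτ : 0 ≤ stepDeriv (z.2 / β - 1) / β * parabCut R z ^ (2 * n + 2) := by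
    have := stepDeriv_nonneg (z.2 / β - 1)
    positivity
  have hinner : ⟪profile σ d y • cutoffGrad β R (2 * n) z
        + (cutoff β R (2 * n) z * profileDeriv σ d y) • g, g⟫
      = -(2 * profile σ d y * cutoffCoef β R (2 * n) z * ⟪z.1, g⟫)
        - cutoff β R (2 * n) z * (d / σ * (1 + y / σ) ^ (-d - 1)) * ‖g‖ ^ 2 := by
    rw [inner_add_left, inner_smul_left, inner_smul_left, cutoffGrad, inner_smul_left,
      real_inner_self_eq_norm_sq, profileDeriv]
    simp only [conj_trivial]
    ring
  rw [hinner]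
  by_cases hs : z ∈ shell N R
  swap
  · rw [indicator_of_notMem hs, cutoffTime, cutoffCoef_eq_zero_of_notMem_shell hR hz hs]
    have h1 : 0 ≤ cutoff β R (2 * n) z * (d / σ * (1 + y / σ) ^ (-d - 1)) * ‖g‖ ^ 2 * c := by
      positivity
    have h2 := mul_nonneg hτ hH0
    nlinarith
  rw [indicator_of_mem hs]
  set χ := timeCut β z
  set ξ := parabCut R z with hξ
  set κ := cutoffCoef β R (2 * n) z
  set B := d / σ * (1 + y / σ) ^ (-d - 1) with hBdef
  set h := profile σ d y
  set H := profilePrim σ d y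
  set w := (1 + y / σ) ^ (1 + d) with hw
  have hφ : cutoff β R (2 * n) z = χ * ξ ^ (2 * n) * ξ ^ 2 := by
    rw [cutoff, pow_add]; ring
  set P := χ * ξ ^ (2 * n) with hP
  have hP0 : 0 ≤ P := by positivity
  have hw0 : 0 ≤ w := by positivity
  set k : ℝ := (((2 * n : ℕ) : ℝ) + 2) * M with hk
  have hk0 : 0 ≤ k := by positivity
  have hx : ‖z.1‖ ≤ 2 * R := by
    have := hs.2.2
    exact (abs_le_of_sq_le_sq' (by nlinarith) (by linarith)).2
  have hgrad : -(2 * h * κ * ⟪z.1, g⟫) ≤ P * (2 * (4 * k / R) * (ξ * ‖g‖)) := by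
    have h1 : -⟪z.1, g⟫ ≤ 2 * R * ‖g‖ := by
      have := neg_le_of_abs_le (abs_real_inner_le_norm z.1 g)
      nlinarith [mul_le_mul_of_nonneg_right hx (norm_nonneg g)]
    calc -(2 * h * κ * ⟪z.1, g⟫) = 2 * h * κ * (-⟪z.1, g⟫) := by ring
      _ ≤ 2 * h * κ * (2 * R * ‖g‖) := by gcongr
      _ ≤ 2 * 2 * (P * ξ * (k / R ^ 2)) * (2 * R * ‖g‖) := by gcongr
      _ = _ := by field_simp; ring
  have hsq : -(2 * h * κ * ⟪z.1, g⟫) - P * ξ ^ 2 * B * ‖g‖ ^ 2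
      ≤ P * ((4 * k / R) ^ 2 / B) := by
    have := mul_le_mul_of_nonneg_left
      (two_mul_sub_mul_sq_le (A := 4 * k / R) (y := ξ * ‖g‖) hB) hP0
    calc _ ≤ P * (2 * (4 * k / R) * (ξ * ‖g‖)) - P * ξ ^ 2 * B * ‖g‖ ^ 2 := by gcongr
      _ = P * (2 * (4 * k / R) * (ξ * ‖g‖) - B * (ξ * ‖g‖) ^ 2) := by ring
      _ ≤ _ := this
  have hAB : (4 * k / R) ^ 2 / B = σ / R ^ 2 * w * (16 * k ^ 2 / d) := by
    have : B = d / (σ * w) := by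
      rw [hBdef, hw, show -d - 1 = -(1 + d) by ring, rpow_neg (by linarith)]
      field_simp
    have hw' : 0 < w := by positivity
    rw [this]; field_simp; ring
  have hAB0 : 0 ≤ (4 * k / R) ^ 2 / B := by positivity
  have hterm1 : (-(2 * h * κ * ⟪z.1, g⟫) - P * ξ ^ 2 * B * ‖g‖ ^ 2) * c
      ≤ P * (σ / R ^ 2 * w * (16 * k ^ 2 / d)) := by
    rw [← hAB]
    calc _ ≤ P * ((4 * k / R) ^ 2 / B) * c := by gcongr
      _ ≤ P * ((4 * k / R) ^ 2 / B) * 1 := by gcongr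
      _ = _ := mul_one _
  have hterm2 : κ * H ≤ P * (σ / R ^ 2 * w * (3 * k)) := by
    calc κ * H ≤ (P * ξ * (k / R ^ 2)) * (3 * σ * w) := by gcongr
      _ ≤ (P * 1 * (k / R ^ 2)) * (3 * σ * w) := by gcongr
      _ = _ := by ring
  have hcut : P * w ≤ 4 * (1 + P * ξ ^ 2 * (y / σ) ^ q) := by
    have h1 := mul_le_mul_of_nonneg_left
      (pow_mul_one_add_rpow_le hd0 hd hdq hn hξ0 hξ1 (by positivity : 0 ≤ y / σ)) hχ0
    have h2 : χ * (4 * (1 + ξ ^ (2 * n + 2) * (y / σ) ^ q))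
        = 4 * (χ + P * ξ ^ 2 * (y / σ) ^ q) := by
      rw [hP, pow_add]; ring
    rw [h2] at h1
    calc P * w = χ * (ξ ^ (2 * n) * w) := by rw [hP]; ring
      _ ≤ _ := h1
      _ ≤ _ := by gcongr
  rw [cutoffTime, hφ]
  calc _ = (-(2 * h * κ * ⟪z.1, g⟫) - P * ξ ^ 2 * B * ‖g‖ ^ 2) * c + κ * H
        - stepDeriv (z.2 / β - 1) / β * ξ ^ (2 * n + 2) * H := by ring
    _ ≤ P * (σ / R ^ 2 * w * (16 * k ^ 2 / d)) + P * (σ / R ^ 2 * w * (3 * k)) := by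
        linarith [mul_nonneg hτ hH0]
    _ = (P * w) * (σ / R ^ 2 * (16 * k ^ 2 / d + 3 * k)) := by ring
    _ ≤ (4 * (1 + P * ξ ^ 2 * (y / σ) ^ q)) * (σ / R ^ 2 * (16 * k ^ 2 / d + 3 * k)) := by
        gcongr
    _ = _ := by rw [estConst, ← hk]; ring

section WeakSolution

variable {N : ℕ}

instance isAddHaarMeasure_volume_prod : (volume : Measure (Euc N × ℝ)).IsAddHaarMeasure :=
  inferInstanceAs ((volume : Measure (Euc N)).prod (volume : Measure ℝ)).IsAddHaarMeasure

lemma isOpen_Sset : IsOpen (Sset N) := isOpen_lt continuous_const continuous_snd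

lemma measurableSet_Sset : MeasurableSet (Sset N) := isOpen_Sset.measurableSet

lemma muS_one :
    muS (fun _ : Euc N => (1 : ℝ)) = (volume : Measure (Euc N × ℝ)).restrict (Sset N) := by
  have h1 : muA (fun _ : Euc N => (1 : ℝ)) = volume := by
    simp only [muA, ENNReal.ofReal_one]
    exact withDensity_one
  have h2 : Sset N = (univ : Set (Euc N)) ×ˢ Ioi (0 : ℝ) := by
    ext z; simp [Sset]
  rw [muS, h1, h2, Measure.volume_eq_prod, ← Measure.prod_restrict, Measure.restrict_univ]

lemma hasFDerivAt_cutoff_mul_comp {β R : ℝ} {m : ℕ} {u : Euc N × ℝ → ℝ} {G : ℝ → ℝ} {G' τ : ℝ}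
    {g : Euc N} {z : Euc N × ℝ} (hu : HasFDerivAt u (pairCLM g τ) z) (hG : HasDerivAt G G' (u z)) :
    HasFDerivAt (fun z => cutoff β R m z * G (u z))
      (pairCLM (G (u z) • cutoffGrad β R m z + (cutoff β R m z * G') • g)
        (cutoffTime β R m z * G (u z) + cutoff β R m z * G' * τ)) z := by
  refine ((hasFDerivAt_cutoff z).mul (hG.comp_hasFDerivAt z hu)).congr_fderiv ?_
  ext w
  · simp [pairCLM]
    ring
  · simp [pairCLM]
    ring

lemma cutoff_mul_hasFDerivAt_zero {β R : ℝ} {m : ℕ} (hβ : 0 < β) (hR : 0 < R)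
    (G : Euc N × ℝ → ℝ) {z : Euc N × ℝ} (hz : z ∉ Sset N) :
    HasFDerivAt (fun z => cutoff β R m z * G z) (0 : (Euc N × ℝ) →L[ℝ] ℝ) z := by
  have h0 : cutoff (N := N) β R m =ᶠ[𝓝 z] 0 := notMem_tsupport_iff_eventuallyEq.1
    fun h => hz (cutoffSet_subset hβ (tsupport_cutoff_subset hβ hR h))
  refine (hasFDerivAt_const (0 : ℝ) z).congr_of_eventuallyEq ?_
  filter_upwards [h0] with w hw
  simp [hw]

lemma aestronglyMeasurable_grad {u : Euc N × ℝ → ℝ} {gu : Euc N × ℝ → Euc N}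
    {ut : Euc N × ℝ → ℝ} {ν : Measure (Euc N × ℝ)}
    (h : ∀ᵐ z ∂ν, HasFDerivAt u (pairCLM (gu z) (ut z)) z) : AEStronglyMeasurable gu ν := by
  have hm : Measurable fun z => (InnerProductSpace.toDual ℝ (Euc N)).symm
      ((fderiv ℝ u z).comp (ContinuousLinearMap.inl ℝ (Euc N) ℝ)) := by
    have hc : Continuous fun L : (Euc N × ℝ) →L[ℝ] ℝ => (InnerProductSpace.toDual ℝ (Euc N)).symm
        (L.comp (ContinuousLinearMap.inl ℝ (Euc N) ℝ)) := by fun_prop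
    exact hc.measurable.comp (measurable_fderiv ℝ u)
  refine hm.aestronglyMeasurable.congr ?_
  filter_upwards [h] with z hz
  rw [hz.fderiv, LinearIsometryEquiv.symm_apply_eq]
  ext w
  simp [pairCLM]

variable {θ q : ℝ} {u : Euc N × ℝ → ℝ} {gu : Euc N × ℝ → Euc N} {ut : Euc N × ℝ → ℝ}

lemma IsWeakSol.ae_hasFDerivAt {p m q : ℝ} {V : Euc N × ℝ → ℝ} {f : ℝ → ℝ} {a : Euc N → ℝ}
    (hu : IsWeakSol N p m q V f a u gu ut) :
    ∀ᵐ z ∂(volume : Measure (Euc N × ℝ)).restrict (Sset N),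
      HasFDerivAt u (pairCLM (gu z) (ut z)) z := by
  filter_upwards [hu.deriv_ae, hu.locLip.ae_differentiableAt isOpen_Sset] with z h1 h2
  exact h1 h2

lemma integrable_of_integrableOn_cutoffSet {β R : ℝ} {ν : Measure (Euc N × ℝ)}
    {f : Euc N × ℝ → ℝ} (h : IntegrableOn f (cutoffSet N β R) ν)
    (h0 : ∀ z ∉ cutoffSet N β R, f z = 0) : Integrable f ν :=
  (integrableOn_iff_integrable_of_support_subset
    fun z hz => by_contra fun h' => hz (h0 z h')).1 h

/-- The time derivative of a compactly supported Lipschitz function integrates to zero. -/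
lemma integral_time_deriv_eq_zero {β R : ℝ} {m : ℕ} (hβ : 0 < β) (hR : 0 < R)
    (hlip : LocallyLipschitzOn (Sset N) u)
    (hder : ∀ᵐ z ∂(volume : Measure (Euc N × ℝ)).restrict (Sset N),
      HasFDerivAt u (pairCLM (gu z) (ut z)) z) {G G' : ℝ → ℝ}
    (hG : ∀ z ∈ Sset N, ContDiffAt ℝ 1 G (u z))
    (hG' : ∀ z ∈ Sset N, HasDerivAt G (G' (u z)) (u z)) :
    ∫ z in Sset N, (cutoffTime β R m z * G (u z) + cutoff β R m z * G' (u z) * ut z) = 0 := by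
  have hsupp := tsupport_cutoff_subset (N := N) (m := m) hβ hR
  have hlip' : LocallyLipschitz fun z => cutoff β R m z * G (u z) :=
    locallyLipschitz_mul_comp isOpen_Sset contDiff_cutoff (hsupp.trans (cutoffSet_subset hβ))
      hlip hG
  have hcs : HasCompactSupport fun z => cutoff β R m z * G (u z) :=
    HasCompactSupport.mul_right (HasCompactSupport.intro (isCompact_cutoffSet hβ hR)
      fun z hz => cutoff_eq_zero hβ hR hz)
  rw [← hlip'.integral_lineDeriv_eq_zero (μ := volume) hcs ((0 : Euc N), (1 : ℝ)),
    ← integral_indicator measurableSet_Sset]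
  refine integral_congr_ae ?_
  rw [ae_restrict_iff' measurableSet_Sset] at hder
  filter_upwards [hder] with z hz
  by_cases hzS : z ∈ Sset N
  · rw [indicator_of_mem hzS,
      (hasFDerivAt_cutoff_mul_comp (hz hzS) (hG' z hzS)).hasLineDerivAt _ |>.lineDeriv]
    simp [pairCLM]
  · rw [indicator_of_notMem hzS,
      (cutoff_mul_hasFDerivAt_zero hβ hR (fun z => G (u z)) hzS).hasLineDerivAt _ |>.lineDeriv]
    simp

lemma integrable_cutoff_mul_rpow {β R : ℝ} {m : ℕ} (hβ : 0 < β) (hR : 0 < R)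
    (hu : IsWeakSol N 2 1 q (fun _ => 1) (fun s => (s ^ 2 + 1) ^ (-θ)) (fun _ => 1) u gu ut) :
    Integrable (fun z => cutoff β R m z * u z ^ q)
      ((volume : Measure (Euc N × ℝ)).restrict (Sset N)) := by
  have h := hu.int_uqV.integrableOn_compact_subset (cutoffSet_subset hβ) (isCompact_cutoffSet hβ hR)
  rw [muS_one] at h
  simp only [mul_one] at h
  exact integrable_of_integrableOn_cutoffSet
    (h.continuousOn_mul contDiff_cutoff.continuous.continuousOn (isCompact_cutoffSet hβ hR))
    fun z hz => by simp [cutoff_eq_zero hβ hR hz]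

lemma volume_shell_le {R : ℝ} (hR : 0 < R) : (volume : Measure (Euc N × ℝ)) (shell N R) ≤
    ENNReal.ofReal (2 ^ N * 2 * (volume (ball (0 : Euc N) 1)).toReal * R ^ (N + 2)) := by
  have hsub : shell N R ⊆ closedBall (0 : Euc N) (2 * R) ×ˢ Icc 0 (2 * R ^ 2) := by
    rintro z ⟨h1, -, h2⟩
    refine ⟨?_, h1.le, by nlinarith [sq_nonneg ‖z.1‖]⟩
    rw [mem_closedBall_zero_iff]
    exact (abs_le_of_sq_le_sq' (by nlinarith) (by linarith)).2
  refine (measure_mono hsub).trans ?_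
  rw [Measure.volume_eq_prod, Measure.prod_prod, Measure.addHaar_closedBall _ _ (by positivity),
    Real.volume_Icc, finrank_euclideanSpace_fin]
  nth_rewrite 1 [← ENNReal.ofReal_toReal (measure_ball_lt_top (x := (0 : Euc N)) (r := 1)).ne]
  rw [← ENNReal.ofReal_mul (by positivity), ← ENNReal.ofReal_mul (by positivity)]
  refine ENNReal.ofReal_le_ofReal (le_of_eq ?_)
  rw [sub_zero, mul_pow, pow_add]
  ring

end WeakSolution

section Estimate

variable {N : ℕ} {θ q : ℝ} {u : Euc N × ℝ → ℝ} {gu : Euc N × ℝ → Euc N} {ut : Euc N × ℝ → ℝ}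

/-- The a priori estimate obtained by testing with `cutoff * profile u`. -/
lemma integral_cutoff_mul_rpow_le {σ d β R M : ℝ} {n : ℕ} (hθ : 0 ≤ θ) (hσ : 0 < σ) (hd0 : 0 < d)
    (hd : d ≤ 1 / 2) (hdq : 1 + d < q) (hn : (1 + d) / (q - 1 - d) ≤ n) (hβ : 0 < β) (hR : 0 < R)
    (hM0 : 0 ≤ M) (hM : ∀ x, stepDeriv x ≤ M)
    (hu : IsWeakSol N 2 1 q (fun _ => 1) (fun s => (s ^ 2 + 1) ^ (-θ)) (fun _ => 1) u gu ut) :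
    ∫ z in Sset N, cutoff β R (2 * n) z * u z ^ q ≤
      ∫ z in Sset N, (shell N R).indicator (fun z => estConst d M (2 * n) * (σ / R ^ 2) *
        (1 + cutoff β R (2 * n) z * (u z / σ) ^ q)) z := by
  set ν := (volume : Measure (Euc N × ℝ)).restrict (Sset N) with hν
  have hK := isCompact_cutoffSet (N := N) hβ hR
  have hKS := cutoffSet_subset (N := N) (R := R) hβ
  have hd1 : d < 1 := by linarith
  have hcu : ContinuousOn u (Sset N) := hu.locLip.continuousOn
  have hder := hu.ae_hasFDerivAt
  have hcomp : ∀ G : ℝ → ℝ, (∀ y, 0 ≤ y → ContDiffAt ℝ 1 G y) →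
      ContinuousOn (fun z => G (u z)) (cutoffSet N β R) := fun G hG z hz =>
    ((hG _ (hu.nonneg z (hKS hz))).continuousAt.comp_continuousWithinAt
      ((hcu z (hKS hz)).mono hKS))
  have hcP := hcomp _ fun y hy => contDiffAt_profile (d := d) hσ hy
  have hcD := hcomp _ fun y hy => contDiffAt_profileDeriv (d := d) hσ hy
  have hcH := hcomp _ fun y hy => contDiffAt_profilePrim (d := d) hσ hy
  have hcC : ContinuousOn (cutoff (N := N) β R (2 * n)) (cutoffSet N β R) :=
    contDiff_cutoff.continuous.continuousOn
  have hcT : ContinuousOn (cutoffTime (N := N) β R (2 * n)) (cutoffSet N β R) :=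
    continuous_cutoffTime.continuousOn
  have hcG : ContinuousOn (cutoffGrad (N := N) β R (2 * n)) (cutoffSet N β R) :=
    continuous_cutoffGrad.continuousOn
  have hcU : ContinuousOn u (cutoffSet N β R) := hcu.mono hKS
  have hνK : ν (cutoffSet N β R) < ⊤ := (Measure.restrict_apply_le _ _).trans_lt hK.measure_lt_top
  set gψ : Euc N × ℝ → Euc N := fun z => profile σ d (u z) • cutoffGrad β R (2 * n) z
    + (cutoff β R (2 * n) z * profileDeriv σ d (u z)) • gu z with hgψ
  set tψ : Euc N × ℝ → ℝ := fun z => cutoffTime β R (2 * n) z * profile σ d (u z)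
    + cutoff β R (2 * n) z * profileDeriv σ d (u z) * ut z with htψ
  have hgψ0 : ∀ z ∉ cutoffSet N β R, gψ z = 0 := fun z hz => by
    simp [hgψ, cutoffGrad_eq_zero hβ hR hz, cutoff_eq_zero hβ hR hz]
  have htψ0 : ∀ z ∉ cutoffSet N β R, tψ z = 0 := fun z hz => by
    simp [htψ, cutoffTime_eq_zero hβ hR hz, cutoff_eq_zero hβ hR hz]
  have hweak := hu.weak_ineq (fun z => cutoff β R (2 * n) z * profile σ d (u z)) gψ tψ
    (fun z => by
      by_cases hz : z ∈ cutoffSet N β R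
      · exact mul_nonneg (cutoff_nonneg z)
          (zero_le_one.trans (one_le_profile hσ (hu.nonneg z (hKS hz))))
      · simp [cutoff_eq_zero hβ hR hz])
    (locallyLipschitz_mul_comp isOpen_Sset contDiff_cutoff
      ((tsupport_cutoff_subset hβ hR).trans hKS) hu.locLip
      fun z hz => contDiffAt_profile hσ (hu.nonneg z hz))
    (HasCompactSupport.mul_right
      (HasCompactSupport.intro hK fun z hz => cutoff_eq_zero hβ hR hz))
    ((tsupport_mul_subset_left).trans ((tsupport_cutoff_subset hβ hR).trans hKS))
    (by
      have hder' := hder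
      rw [ae_restrict_iff' measurableSet_Sset] at hder'
      filter_upwards [hder'] with z hz _
      by_cases hzS : z ∈ Sset N
      · exact hasFDerivAt_cutoff_mul_comp (hz hzS) (hasDerivAt_profile hσ (hu.nonneg z hzS))
      · have hzK : z ∉ cutoffSet N β R := fun h => hzS (hKS h)
        refine (cutoff_mul_hasFDerivAt_zero hβ hR _ hzS).congr_fderiv ?_
        rw [hgψ0 z hzK, htψ0 z hzK]
        ext w <;> simp [pairCLM])
  rw [muS_one] at hweak
  simp only [mul_one, sub_self, rpow_zero] at hweak
  have huq := integrable_cutoff_mul_rpow (m := 2 * n) hβ hR hu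
  have hI1 : Integrable (fun z => cutoff β R (2 * n) z * profile σ d (u z) * u z ^ q) ν := by
    refine integrable_of_integrableOn_cutoffSet (β := β) (R := R) ?_ fun z hz => by
      simp [cutoff_eq_zero hβ hR hz]
    refine (IntegrableOn.continuousOn_mul hcP huq.integrableOn hK).congr_fun (fun z _ => ?_)
      isClosed_cutoffSet.measurableSet
    ring
  have hlow : ∫ z, cutoff β R (2 * n) z * u z ^ q ∂ν
      ≤ ∫ z, cutoff β R (2 * n) z * profile σ d (u z) * u z ^ q ∂ν := by
    refine integral_mono_ae huq hI1 ?_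
    filter_upwards [ae_restrict_mem measurableSet_Sset] with z hz
    have h1 := one_le_profile (d := d) hσ (hu.nonneg z hz)
    have h2 := mul_nonneg (cutoff_nonneg (β := β) (R := R) (m := 2 * n) z)
      (rpow_nonneg (hu.nonneg z hz) q)
    calc cutoff β R (2 * n) z * u z ^ q = cutoff β R (2 * n) z * u z ^ q * 1 := (mul_one _).symm
      _ ≤ cutoff β R (2 * n) z * u z ^ q * profile σ d (u z) := by gcongr
      _ = _ := by ring
  have hut : IntegrableOn (fun z => u z * ut z) (cutoffSet N β R) ν := by
    have := hu.int_ut.integrableOn_compact_subset hKS hK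
    rwa [muS_one] at this
  have hgu : IntegrableOn (fun z => ‖gu z‖ ^ 2) (cutoffSet N β R) ν := by
    have := hu.int_gu.integrableOn_compact_subset hKS hK
    rw [muS_one] at this
    simpa using this
  have hDut : IntegrableOn (fun z => cutoff β R (2 * n) z * profileDeriv σ d (u z) * (u z * ut z))
      (cutoffSet N β R) ν := IntegrableOn.continuousOn_mul (hcC.mul hcD) hut hK
  have hone : IntegrableOn (fun _ => (1 : ℝ)) (cutoffSet N β R) ν := integrableOn_const hνK.ne
  have hI2 : Integrable (fun z => tψ z * u z) ν := by
    refine integrable_of_integrableOn_cutoffSet (β := β) (R := R) ?_ fun z hz => by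
      simp [htψ0 z hz]
    refine ((IntegrableOn.continuousOn_mul ((hcT.mul hcP).mul hcU) hone hK).add hDut).congr_fun
      (fun z _ => ?_) isClosed_cutoffSet.measurableSet
    simp only [htψ, Pi.add_apply, Pi.mul_apply]
    ring
  have hI3 : Integrable (fun z => cutoffTime β R (2 * n) z *
      (u z * profile σ d (u z) - profilePrim σ d (u z))
      + cutoff β R (2 * n) z * (u z * profileDeriv σ d (u z)) * ut z) ν := by
    refine integrable_of_integrableOn_cutoffSet (β := β) (R := R) ?_ fun z hz => by
      simp [cutoffTime_eq_zero hβ hR hz, cutoff_eq_zero hβ hR hz]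
    refine ((IntegrableOn.continuousOn_mul (hcT.mul ((hcU.mul hcP).sub hcH)) hone hK).add
      hDut).congr_fun (fun z _ => ?_) isClosed_cutoffSet.measurableSet
    simp only [Pi.add_apply, Pi.mul_apply, Pi.sub_apply]
    ring
  have hzero : ∫ z, (cutoffTime β R (2 * n) z *
      (u z * profile σ d (u z) - profilePrim σ d (u z))
      + cutoff β R (2 * n) z * (u z * profileDeriv σ d (u z)) * ut z) ∂ν = 0 := by
    refine integral_time_deriv_eq_zero (G := fun y => y * profile σ d y - profilePrim σ d y)
      (G' := fun y => y * profileDeriv σ d y) hβ hR hu.locLip hder (fun z hz => ?_) fun z hz => ?_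
    · have h0 := hu.nonneg z hz
      exact (contDiffAt_id.mul (contDiffAt_profile hσ h0)).sub (contDiffAt_profilePrim hσ h0)
    · have h0 := hu.nonneg z hz
      refine (((hasDerivAt_id (u z)).mul (hasDerivAt_profile hσ h0)).sub
        (hasDerivAt_profilePrim hσ hd1 h0)).congr_deriv ?_
      simp
  have hf0 : ∀ s : ℝ, 0 ≤ (s ^ 2 + 1) ^ (-θ) := fun s => by positivity
  have hf1 : ∀ s : ℝ, (s ^ 2 + 1) ^ (-θ) ≤ 1 := fun s =>
    rpow_le_one_of_one_le_of_nonpos (by nlinarith [sq_nonneg s]) (by linarith)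
  have hmg := aestronglyMeasurable_grad hder
  have hI4 : Integrable (fun z => ⟪gψ z, gu z⟫ * (‖gu z‖ ^ 2 + 1) ^ (-θ)) ν := by
    refine integrable_of_integrableOn_cutoffSet (β := β) (R := R) ?_ fun z hz => by
      simp [hgψ0 z hz]
    have hbound : IntegrableOn (fun z => ‖cutoffGrad β R (2 * n) z‖ * (1 + ‖gu z‖ ^ 2)
        + |cutoff β R (2 * n) z * profileDeriv σ d (u z)| * ‖gu z‖ ^ 2) (cutoffSet N β R) ν :=
      (IntegrableOn.continuousOn_mul hcG.norm (hone.add hgu) hK).add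
        (IntegrableOn.continuousOn_mul (hcC.mul hcD).abs hgu hK)
    refine Integrable.mono' hbound ?_ ?_
    · have hmfun : ∀ G : ℝ → ℝ, (∀ y, 0 ≤ y → ContDiffAt ℝ 1 G y) →
          AEStronglyMeasurable (fun z => G (u z)) (ν.restrict (cutoffSet N β R)) := fun G hG => by
        exact ((hcomp G hG).aestronglyMeasurable isClosed_cutoffSet.measurableSet).mono_measure
          (Measure.restrict_mono_measure Measure.restrict_le_self _)
      have hθc : Continuous fun v : Euc N => (‖v‖ ^ 2 + 1) ^ (-θ) :=
        (by fun_prop : Continuous fun v : Euc N => ‖v‖ ^ 2 + 1).rpow_const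
          fun v => Or.inl (by positivity)
      have hmg' := hmg.mono_measure (Measure.restrict_le_self (s := cutoffSet N β R) (μ := ν))
      refine AEStronglyMeasurable.mul (AEStronglyMeasurable.inner ?_ hmg')
        (hθc.comp_aestronglyMeasurable hmg')
      exact ((hmfun _ fun y hy => contDiffAt_profile (d := d) hσ hy).smul
        continuous_cutoffGrad.aestronglyMeasurable).add
        ((contDiff_cutoff.continuous.aestronglyMeasurable.mul
          (hmfun _ fun y hy => contDiffAt_profileDeriv (d := d) hσ hy)).smul hmg')
    · filter_upwards [ae_restrict_mem isClosed_cutoffSet.measurableSet] with z hz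
      have h0 := hu.nonneg z (hKS hz)
      have h1 := one_le_profile (d := d) hσ h0
      have h2 := profile_le_two hσ hd0 h0
      have h3 : ‖gψ z‖ ≤ 2 * ‖cutoffGrad β R (2 * n) z‖
          + |cutoff β R (2 * n) z * profileDeriv σ d (u z)| * ‖gu z‖ := by
        refine (norm_add_le _ _).trans ?_
        rw [norm_smul, norm_smul, Real.norm_eq_abs, Real.norm_eq_abs, abs_of_nonneg (by linarith)]
        gcongr
      rw [norm_mul, Real.norm_of_nonneg (hf0 _)]
      calc _ ≤ ‖gψ z‖ * ‖gu z‖ * 1 := by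
            gcongr
            · exact norm_inner_le_norm _ _
            · exact hf1 _
        _ ≤ (2 * ‖cutoffGrad β R (2 * n) z‖
          + |cutoff β R (2 * n) z * profileDeriv σ d (u z)| * ‖gu z‖) * ‖gu z‖ * 1 := by gcongr
        _ ≤ _ := by
          nlinarith [mul_nonneg (norm_nonneg (cutoffGrad β R (2 * n) z))
            (sq_nonneg (1 - ‖gu z‖))]
  have hI5 : Integrable ((shell N R).indicator (fun z => estConst d M (2 * n) * (σ / R ^ 2) *
        (1 + cutoff β R (2 * n) z * (u z / σ) ^ q))) ν := by
    rw [integrable_indicator_iff measurableSet_shell]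
    refine Integrable.const_mul (Integrable.add ?_ ?_) _
    · exact integrableOn_const ((Measure.restrict_apply_le _ _).trans_lt
        ((volume_shell_le hR).trans_lt ENNReal.ofReal_lt_top)).ne
    · refine Integrable.integrableOn ((huq.const_mul (σ⁻¹ ^ q)).congr ?_)
      filter_upwards [ae_restrict_mem measurableSet_Sset] with z hz
      rw [div_eq_mul_inv, mul_rpow (hu.nonneg z hz) (by positivity)]
      ring
  refine hlow.trans (hweak.trans ?_)
  have hsplit : (∫ z, ⟪gψ z, gu z⟫ * (‖gu z‖ ^ 2 + 1) ^ (-θ) ∂ν) - ∫ z, tψ z * u z ∂ν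
      = ∫ z, (⟪gψ z, gu z⟫ * (‖gu z‖ ^ 2 + 1) ^ (-θ)
          - cutoffTime β R (2 * n) z * profilePrim σ d (u z)) ∂ν := by
    have hI42 : Integrable (fun z => ⟪gψ z, gu z⟫ * (‖gu z‖ ^ 2 + 1) ^ (-θ) - tψ z * u z) ν :=
      hI4.sub hI2
    rw [← integral_sub hI4 hI2, ← add_zero (∫ z, (_ - _) ∂ν), ← hzero, ← integral_add hI42 hI3]
    refine integral_congr_ae (Eventually.of_forall fun z => ?_)
    simp only [htψ]
    ring
  have hI6 : Integrable (fun z => ⟪gψ z, gu z⟫ * (‖gu z‖ ^ 2 + 1) ^ (-θ)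
      - cutoffTime β R (2 * n) z * profilePrim σ d (u z)) ν := by
    refine ((hI4.sub hI2).add hI3).congr (Eventually.of_forall fun z => ?_)
    simp only [htψ, Pi.sub_apply, Pi.add_apply]
    ring
  rw [hsplit]
  refine integral_mono_ae hI6 hI5 ?_
  filter_upwards [ae_restrict_mem measurableSet_Sset] with z hz
  exact pointwise_estimate hσ hd0 hd hdq hn hβ hR hM0 hM (hu.nonneg z hz) (hf0 _) (hf1 _) hz _

end Estimate

section Limit

variable {N : ℕ} {θ q : ℝ} {u : Euc N × ℝ → ℝ} {gu : Euc N × ℝ → Euc N} {ut : Euc N × ℝ → ℝ}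

lemma eventually_cutoff_eq_one {m : ℕ} {z : Euc N × ℝ} (hz : 0 < z.2) :
    ∀ᶠ R in atTop, cutoff R⁻¹ R m z = 1 ∧ z ∉ shell N R := by
  filter_upwards [eventually_ge_atTop (2 / z.2), eventually_gt_atTop (‖z.1‖ ^ 2 + z.2),
    eventually_ge_atTop 1] with R h1 h2 h3
  have h4 : ‖z.1‖ ^ 2 + z.2 < R ^ 2 := by nlinarith
  rw [div_le_iff₀ hz] at h1
  refine ⟨?_, fun h => h4.not_ge h.2.1⟩
  have h5 : 1 ≤ z.2 / R⁻¹ - 1 := by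
    rw [div_inv_eq_mul]; linarith
  have h6 : 1 ≤ parabArg R z := by
    have : (‖z.1‖ ^ 2 + z.2) / R ^ 2 ≤ 1 := (div_le_one (by positivity)).2 h4.le
    rw [parabArg]; linarith
  rw [cutoff, timeCut, parabCut, smoothTransition.one_of_one_le h5,
    smoothTransition.one_of_one_le h6]
  simp

/-- The scaled a priori estimate in the subcritical range. -/
lemma exists_integral_cutoff_le (hN : 1 ≤ N) (hθ : 0 ≤ θ) (hq1 : 1 < q) (hq2 : q ≤ 1 + 2 / (N : ℝ))
    (hu : IsWeakSol N 2 1 q (fun _ => 1) (fun s => (s ^ 2 + 1) ^ (-θ)) (fun _ => 1) u gu ut) :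
    ∃ (C : ℝ) (m : ℕ), 0 < C ∧ ∀ β R l : ℝ, 0 < β → 1 ≤ R → 0 < l →
      ∫ z in Sset N, cutoff β R m z * u z ^ q ≤ C * (l + l ^ (1 - q) *
        ∫ z in Sset N, (shell N R).indicator (fun z => cutoff β R m z * u z ^ q) z) := by
  have hN' : (1 : ℝ) ≤ N := by exact_mod_cast hN
  have hq3 : (q - 1) * N ≤ 2 := by
    rw [← le_div_iff₀ (by linarith)]; linarith
  have hq4 : q - 1 ≤ 2 := by nlinarith
  obtain ⟨M, hM0, hM⟩ := exists_stepDeriv_le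
  set d := (q - 1) / 4 with hd
  have hd0 : 0 < d := by rw [hd]; linarith
  obtain ⟨n, hn⟩ := exists_nat_ge ((1 + d) / (q - 1 - d))
  set E := estConst d M (2 * n) with hE
  have hE0 : 0 ≤ E := estConst_nonneg hd0 hM0
  set A := 2 ^ N * 2 * (volume (ball (0 : Euc N) 1)).toReal with hA
  have hA0 : 0 ≤ A := by positivity
  refine ⟨E * (A + 1) + 1, 2 * n, by positivity, fun β R l hβ hR hl => ?_⟩
  have hR0 : 0 < R := by linarith
  set ν := (volume : Measure (Euc N × ℝ)).restrict (Sset N) with hν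
  set σ := l * R ^ (-(2 / (q - 1))) with hσ
  have hσ0 : 0 < σ := by positivity
  have huq := integrable_cutoff_mul_rpow (m := 2 * n) hβ hR0 hu
  set J := ∫ z, (shell N R).indicator (fun z => cutoff β R (2 * n) z * u z ^ q) z ∂ν with hJ
  have hJ0 : 0 ≤ J := by
    refine integral_nonneg_of_ae ?_
    filter_upwards [ae_restrict_mem measurableSet_Sset] with z hz
    exact indicator_apply_nonneg fun _ =>
      mul_nonneg (cutoff_nonneg z) (rpow_nonneg (hu.nonneg z hz) q)
  have hfin : ν (shell N R) < ⊤ := (Measure.restrict_apply_le _ _).trans_lt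
    ((volume_shell_le hR0).trans_lt ENNReal.ofReal_lt_top)
  have hvol : ν.real (shell N R) ≤ A * R ^ (N + 2) :=
    ENNReal.toReal_le_of_le_ofReal (by positivity)
      ((Measure.restrict_apply_le _ _).trans (volume_shell_le hR0))
  refine (integral_cutoff_mul_rpow_le hθ hσ0 hd0 (by rw [hd]; linarith) (by rw [hd]; linarith) hn
    hβ hR0 hM0 hM hu).trans ?_
  have hsplit : ∫ z, (shell N R).indicator (fun z => E * (σ / R ^ 2) *
      (1 + cutoff β R (2 * n) z * (u z / σ) ^ q)) z ∂ν
      = E * (σ / R ^ 2) * (ν.real (shell N R) + (σ ^ q)⁻¹ * J) := by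
    have hi1 : Integrable ((shell N R).indicator fun _ => (1 : ℝ)) ν :=
      (integrable_indicator_iff measurableSet_shell).2 (integrableOn_const hfin.ne)
    have hi2 : Integrable (fun z => (σ ^ q)⁻¹ *
        (shell N R).indicator (fun z => cutoff β R (2 * n) z * u z ^ q) z) ν :=
      (huq.indicator measurableSet_shell).const_mul _
    have h1 : ν.real (shell N R) = ∫ z, (shell N R).indicator (fun _ => (1 : ℝ)) z ∂ν := by
      rw [integral_indicator measurableSet_shell, setIntegral_const, smul_eq_mul, mul_one]
    rw [h1, hJ, ← integral_const_mul, ← integral_add hi1 hi2, ← integral_const_mul]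
    refine integral_congr_ae ?_
    filter_upwards [ae_restrict_mem measurableSet_Sset] with z hz
    by_cases hs : z ∈ shell N R
    · simp only [indicator_of_mem hs]
      rw [div_rpow (hu.nonneg z hz) hσ0.le]
      ring
    · simp only [indicator_of_notMem hs]
      ring
  rw [hsplit]
  have hone : σ / R ^ 2 * R ^ (N + 2) ≤ l := by
    have h1 : σ / R ^ 2 * R ^ (N + 2) = l * (R ^ (-(2 / (q - 1))) * R ^ N) := by
      rw [hσ, pow_add]; field_simp
    have h2 : R ^ (-(2 / (q - 1))) * R ^ N ≤ 1 := by
      rw [← rpow_natCast, ← rpow_add hR0]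
      refine rpow_le_one_of_one_le_of_nonpos hR ?_
      have : (N : ℝ) ≤ 2 / (q - 1) := by
        rw [le_div_iff₀ (by linarith)]; linarith
      linarith
    rw [h1]
    exact mul_le_of_le_one_right hl.le h2
  have htwo : σ / R ^ 2 * (σ ^ q)⁻¹ = l ^ (1 - q) := by
    have h1 : σ * (σ ^ q)⁻¹ = σ ^ (1 - q) := by
      rw [rpow_sub hσ0, rpow_one, div_eq_mul_inv]
    have h2 : (R ^ (-(2 / (q - 1)))) ^ (1 - q) = R ^ 2 := by
      rw [← rpow_mul hR0.le, ← rpow_natCast]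
      congr 1
      have : q - 1 ≠ 0 := by linarith
      push_cast
      field_simp
      ring
    rw [div_mul_eq_mul_div, h1, hσ, mul_rpow hl.le (by positivity), h2]
    field_simp
  have hl' : 0 ≤ l ^ (1 - q) * J := by positivity
  calc E * (σ / R ^ 2) * (ν.real (shell N R) + (σ ^ q)⁻¹ * J)
      ≤ E * (σ / R ^ 2) * (A * R ^ (N + 2) + (σ ^ q)⁻¹ * J) := by gcongr
    _ = E * A * (σ / R ^ 2 * R ^ (N + 2)) + E * ((σ / R ^ 2 * (σ ^ q)⁻¹) * J) := by ring
    _ ≤ E * A * l + E * (l ^ (1 - q) * J) := by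
        rw [htwo]; gcongr
    _ ≤ (E * (A + 1) + 1) * (l + l ^ (1 - q) * J) := by
        nlinarith [mul_nonneg hE0 hl.le, mul_nonneg hE0 hl', mul_nonneg (mul_nonneg hE0 hA0) hl']

lemma IsWeakSol.integrable_rpow_and_integral_eq_zero (hN : 1 ≤ N) (hθ : 0 ≤ θ) (hq1 : 1 < q)
    (hq2 : q ≤ 1 + 2 / (N : ℝ))
    (hu : IsWeakSol N 2 1 q (fun _ => 1) (fun s => (s ^ 2 + 1) ^ (-θ)) (fun _ => 1) u gu ut) :
    IntegrableOn (fun z => u z ^ q) (Sset N) ∧ ∫ z in Sset N, u z ^ q = 0 := by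
  obtain ⟨C, m, hC, hest⟩ := exists_integral_cutoff_le hN hθ hq1 hq2 hu
  set ν := (volume : Measure (Euc N × ℝ)).restrict (Sset N) with hν
  set r : ℕ → ℝ := fun j => j + 1 with hr
  have hr1 : ∀ j, 1 ≤ r j := fun j => by simp [hr]
  have hr0 : ∀ j, 0 < r j := fun j => zero_lt_one.trans_le (hr1 j)
  have hrtop : Tendsto r atTop atTop :=
    tendsto_atTop_add_const_right _ _ tendsto_natCast_atTop_atTop
  set w : ℕ → Euc N × ℝ → ℝ := fun j z => cutoff (r j)⁻¹ (r j) m z * u z ^ q with hw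
  have hwi : ∀ j, Integrable (w j) ν := fun j =>
    integrable_cutoff_mul_rpow (inv_pos.2 (hr0 j)) (hr0 j) hu
  have hw0 : ∀ j, ∀ z ∈ Sset N, 0 ≤ w j z := fun j z hz =>
    mul_nonneg (cutoff_nonneg z) (rpow_nonneg (hu.nonneg z hz) q)
  have hwle : ∀ j, ∀ z ∈ Sset N, w j z ≤ u z ^ q := fun j z hz =>
    mul_le_of_le_one_left (rpow_nonneg (hu.nonneg z hz) q) (cutoff_le_one z)
  have hev : ∀ z ∈ Sset N, ∀ᶠ j in atTop, w j z = u z ^ q ∧ z ∉ shell N (r j) := fun z hz => by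
    filter_upwards [hrtop.eventually (eventually_cutoff_eq_one (m := m) hz)] with j hj
    exact ⟨by simp [hw, hj.1], hj.2⟩
  have hlim : ∀ᵐ z ∂ν, Tendsto (fun j => w j z) atTop (𝓝 (u z ^ q)) := by
    filter_upwards [ae_restrict_mem measurableSet_Sset] with z hz
    exact tendsto_const_nhds.congr' ((hev z hz).mono fun j hj => hj.1.symm)
  have hlimShell : ∀ᵐ z ∂ν, Tendsto (fun j => (shell N (r j)).indicator (w j) z) atTop (𝓝 0) := by
    filter_upwards [ae_restrict_mem measurableSet_Sset] with z hz
    exact tendsto_const_nhds.congr'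
      ((hev z hz).mono fun j hj => (indicator_of_notMem hj.2 _).symm)
  have hbd : ∀ l, 0 < l → ∀ j, ∫ z, w j z ∂ν ≤
      C * (l + l ^ (1 - q) * ∫ z, (shell N (r j)).indicator (w j) z ∂ν) := fun l hl j =>
    hest _ _ l (inv_pos.2 (hr0 j)) (hr1 j) hl
  have huq : Integrable (fun z => u z ^ q) ν := by
    set l := (2 * C) ^ (1 / (q - 1)) with hl
    have hl0 : 0 < l := by positivity
    have hCl : C * l ^ (1 - q) = 1 / 2 := by
      have : 1 / (q - 1) * (1 - q) = -1 := by
        have : q - 1 ≠ 0 := by linarith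
        field_simp
        ring
      rw [hl, ← rpow_mul (by positivity), this, rpow_neg_one]
      field_simp
    have hunif : ∀ j, ∫⁻ z, ‖w j z‖ₑ ∂ν ≤ ENNReal.ofReal (2 * (C * l)) := fun j => by
      have hnn : 0 ≤ᵐ[ν] w j := by
        filter_upwards [ae_restrict_mem measurableSet_Sset] with z hz using hw0 j z hz
      have h1 : ∫ z, (shell N (r j)).indicator (w j) z ∂ν ≤ ∫ z, w j z ∂ν := by
        refine integral_mono_ae ((hwi j).indicator measurableSet_shell) (hwi j) ?_
        filter_upwards [hnn] with z hz
        exact indicator_le_self' (fun _ _ => hz) z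
      have h2 := hbd l hl0 j
      rw [lintegral_enorm_of_ae_nonneg hnn, ← ofReal_integral_eq_lintegral_ofReal (hwi j) hnn]
      refine ENNReal.ofReal_le_ofReal ?_
      rw [mul_add, ← mul_assoc, hCl] at h2
      linarith
    refine ⟨aestronglyMeasurable_of_tendsto_ae _ (fun j => (hwi j).aestronglyMeasurable) hlim, ?_⟩
    calc ∫⁻ z, ‖u z ^ q‖ₑ ∂ν = ∫⁻ z, liminf (fun j => ‖w j z‖ₑ) atTop ∂ν :=
          lintegral_congr_ae (hlim.mono fun z hz => hz.enorm.liminf_eq.symm)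
      _ ≤ liminf (fun j => ∫⁻ z, ‖w j z‖ₑ ∂ν) atTop :=
          lintegral_liminf_le' fun j => (hwi j).aestronglyMeasurable.enorm
      _ ≤ liminf (fun _ : ℕ => ENNReal.ofReal (2 * (C * l))) atTop :=
          liminf_le_liminf (Eventually.of_forall hunif)
      _ < ⊤ := by rw [liminf_const]; exact ENNReal.ofReal_lt_top
  have hdom : ∀ j, ∀ᵐ z ∂ν, ‖w j z‖ ≤ u z ^ q := fun j => by
    filter_upwards [ae_restrict_mem measurableSet_Sset] with z hz
    rw [Real.norm_of_nonneg (hw0 j z hz)]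
    exact hwle j z hz
  have hI : Tendsto (fun j => ∫ z, w j z ∂ν) atTop (𝓝 (∫ z, u z ^ q ∂ν)) :=
    tendsto_integral_of_dominated_convergence _ (fun j => (hwi j).aestronglyMeasurable) huq hdom
      hlim
  have hJ : Tendsto (fun j => ∫ z, (shell N (r j)).indicator (w j) z ∂ν) atTop (𝓝 0) := by
    have := tendsto_integral_of_dominated_convergence (fun z => u z ^ q)
      (fun j => ((hwi j).indicator (measurableSet_shell (R := r j))).aestronglyMeasurable) huq
      (fun j => (hdom j).mono fun z hz => (norm_indicator_le_norm_self _ _).trans hz) hlimShell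
    simpa using this
  refine ⟨huq, le_antisymm ?_ ?_⟩
  · have hle : ∀ l, 0 < l → ∫ z, u z ^ q ∂ν ≤ C * l := fun l hl => by
      have := ((hJ.const_mul (l ^ (1 - q))).const_add l).const_mul C
      simpa using le_of_tendsto_of_tendsto' hI this (hbd l hl)
    refine le_of_forall_pos_le_add fun ε hε => ?_
    have := hle (ε / C) (by positivity)
    rwa [mul_div_cancel₀ _ hC.ne', ← zero_add ε] at this
  · refine integral_nonneg_of_ae ?_
    filter_upwards [ae_restrict_mem measurableSet_Sset] with z hz
    exact rpow_nonneg (hu.nonneg z hz) q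

end Limit

end Auxiliary

/-- Generalized evolution by mean curvature (I4), Euclidean case: nonexistence for
`∂ₜ u ≥ div(∇u/(|∇u|²+1)^θ) + u^q` (here `p = 2`, `m = 1`, `a ≡ 1`,
`f(s) = (s²+1)^(-θ)`). -/
theorem mean_curvature_nonexistence
    (N : ℕ) (hN : 1 ≤ N) (θ q : ℝ) (hθ : 0 ≤ θ)
    (hq1 : 1 < q) (hq2 : q ≤ 1 + 2 / (N : ℝ))
    (u : Euc N × ℝ → ℝ) (gu : Euc N × ℝ → Euc N) (ut : Euc N × ℝ → ℝ)
    (hu : IsWeakSol N 2 1 q (fun _ => 1) (fun s => (s ^ 2 + 1) ^ (-θ))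
      (fun _ => 1) u gu ut) :
    ∀ᵐ z ∂ ((volume : Measure (Euc N × ℝ)).restrict (Sset N)), u z = 0 := by
  obtain ⟨huq, hzero⟩ := hu.integrable_rpow_and_integral_eq_zero hN hθ hq1 hq2
  have hnn : 0 ≤ᵐ[(volume : Measure (Euc N × ℝ)).restrict (Sset N)] fun z => u z ^ q := by
    filter_upwards [ae_restrict_mem measurableSet_Sset] with z hz
    exact Real.rpow_nonneg (hu.nonneg z hz) q
  filter_upwards [(integral_eq_zero_iff_of_nonneg_ae hnn huq).1 hzero,
    ae_restrict_mem measurableSet_Sset] with z hz hzS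
  exact (Real.rpow_eq_zero (hu.nonneg z hzS) (by linarith)).1 hz

end
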